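/- In the periodic lock scheduling model, let Λ = lcm(λ₁, …, λ_k). For every feasible schedule σ whose long-run average waiting time C_{avg,σ} exists and is finite, there exists a feasible schedule σ' that is periodic with some period P ≤ 8Λ (i.e., σ'(t) = σ'(t + P) for all t ≥ 1) such that C_{avg,σ'} exists and C_{avg,σ'} ≤ C_{avg,σ}. In particular, there exists an optimal schedule that is periodic with period at most 8Λ. (Lemma 3.4.) -/

import Mathlib

/-- A travel direction: downstream `D` or upstream `U`. -/
inductive Dir : Type
  | D | U
deriving DecidableEq

/-- An action of the lock operator in a period: process downstream-waiting
vessels (`D`), process upstream-waiting vessels (`U`), or wait (`W`). -/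
inductive Act : Type
  | D | U | W
deriving DecidableEq

/-- The action processing vessels of direction `δ`. -/
def Dir.toAct : Dir → Act
  | Dir.D => Act.D
  | Dir.U => Act.U

/-- The opposite direction. -/
def Dir.flip : Dir → Dir
  | Dir.D => Dir.U
  | Dir.U => Dir.D

/-- A schedule `σ : ℕ → Act` (time starts at `t = 1`) is feasible if the
subsequence of non-`W` actions strictly alternates between `D` and `U`:
any two non-`W` actions with only `W`'s in between must differ. -/
def Feasible (σ : ℕ → Act) : Prop :=
  ∀ t t' : ℕ, 1 ≤ t → t < t' → σ t ≠ Act.W → σ t' ≠ Act.W →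
    (∀ s : ℕ, t < s → s < t' → σ s = Act.W) → σ t' ≠ σ t

/-- The number of vessels arriving from direction `δ` at time `t`, for `k`
streams with directions `dir`, periodicities `lam` and offsets `mu`:
stream `i` has an arrival at `t` iff `t ≡ mu i (mod lam i)`. -/
def arrivals (k : ℕ) (dir : Fin k → Dir) (lam mu : Fin k → ℕ) (δ : Dir) (t : ℕ) : ℕ :=
  ∑ i ∈ Finset.univ.filter (fun i => dir i = δ),
    if t % lam i = mu i % lam i then 1 else 0

/-- The queue length `n_δ(t)`: number of vessels waiting at the lock in
direction `δ` at time `t`, given arrival pattern `a` and schedule `σ`. -/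
def queueLen (a : Dir → ℕ → ℕ) (σ : ℕ → Act) (δ : Dir) : ℕ → ℕ
  | 0 => 0
  | t + 1 => if σ (t + 1) = δ.toAct then 0 else queueLen a σ δ t + a δ (t + 1)

/-- The waiting cost `C_σ(t) = n_D(t) + n_U(t)` in period `t`. -/
def lockCost (a : Dir → ℕ → ℕ) (σ : ℕ → Act) (t : ℕ) : ℕ :=
  queueLen a σ Dir.D t + queueLen a σ Dir.U t

/-- The long-run average waiting time of `σ` exists and equals `L`. -/
def AvgCostIs (a : Dir → ℕ → ℕ) (σ : ℕ → Act) (L : ℝ) : Prop :=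
  Filter.Tendsto (fun T : ℕ => (∑ t ∈ Finset.Icc 1 T, (lockCost a σ t : ℝ)) / T)
    Filter.atTop (nhds L)

/-- A schedule is single-wait if no two consecutive periods are both `W`. -/
def SingleWait (σ : ℕ → Act) : Prop :=
  ∀ t : ℕ, 1 ≤ t → ¬(σ t = Act.W ∧ σ (t + 1) = Act.W)

/-- A schedule is periodic with period `P` if `σ (t + P) = σ t` for all `t ≥ 1`. -/
def PeriodicSched (σ : ℕ → Act) (P : ℕ) : Prop :=
  ∀ t : ℕ, 1 ≤ t → σ (t + P) = σ t

/-- Long walks cost at least `m` per step, up to an additive constant, if all short closed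
subwalks do. -/
theorem mul_sub_card_le_sum_walk {S : Type*} [Fintype S] (step : S → S → Prop) (c : S → ℕ)
    (m : ℝ) (hm : 0 ≤ m)
    (h : ∀ f : ℕ → S, (∀ n, step (f n) (f (n + 1))) → ∀ i p : ℕ, 0 < p → p ≤ Fintype.card S →
      f (i + p) = f i → m * p ≤ ((∑ k ∈ Finset.range p, c (f (i + k)) : ℕ) : ℝ))
    (T : ℕ) : ∀ f : ℕ → S, (∀ n, step (f n) (f (n + 1))) →
      m * ((T : ℝ) - Fintype.card S) ≤ ((∑ k ∈ Finset.range T, c (f k) : ℕ) : ℝ) := by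
  induction T using Nat.strong_induction_on with
  | _ T ih =>
    intro f hf
    rcases le_or_gt T (Fintype.card S) with hT | hT
    · have h1 : (T : ℝ) ≤ Fintype.card S := by exact_mod_cast hT
      have h2 : (0 : ℝ) ≤ ((∑ k ∈ Finset.range T, c (f k) : ℕ) : ℝ) := Nat.cast_nonneg _
      nlinarith
    · obtain ⟨i, p, hp, hip, hcyc⟩ : ∃ i p, 0 < p ∧ i + p ≤ Fintype.card S ∧ f (i + p) = f i := by
        obtain ⟨a, b, hab, hfab⟩ := Fintype.exists_ne_map_eq_of_card_lt
          (fun k : Fin (Fintype.card S + 1) => f k) (by simp)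
        have ha := a.2
        have hb := b.2
        have hne : (a : ℕ) ≠ b := fun e => hab (Fin.ext e)
        rcases lt_or_gt_of_ne hne with hlt | hlt
        · refine ⟨a, b - a, by omega, by omega, ?_⟩
          rw [Nat.add_sub_cancel' hlt.le, hfab]
        · refine ⟨b, a - b, by omega, by omega, ?_⟩
          rw [Nat.add_sub_cancel' hlt.le, hfab]
      obtain ⟨r, rfl⟩ : ∃ r, T = i + (p + r) := ⟨T - i - p, by omega⟩
      let g : ℕ → S := fun n => if n < i then f n else f (n + p)
      have hg : ∀ n, step (g n) (g (n + 1)) := by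
        intro n
        simp only [g]
        rcases lt_trichotomy (n + 1) i with h1 | h1 | h1
        · rw [if_pos (by omega), if_pos h1]; exact hf n
        · rw [if_pos (by omega), if_neg (by omega), h1, hcyc, ← h1]; exact hf n
        · rw [if_neg (by omega), if_neg (by omega), Nat.add_right_comm]; exact hf _
      have h1 := ih (i + r) (by omega) g hg
      have h2 := h f hf i p hp (by omega) hcyc
      have h3 : ∑ k ∈ Finset.range (i + (p + r)), c (f k) =
          ∑ k ∈ Finset.range (i + r), c (g k) + ∑ k ∈ Finset.range p, c (f (i + k)) := by
        rw [Finset.sum_range_add, Finset.sum_range_add, Finset.sum_range_add]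
        have e1 : ∑ k ∈ Finset.range i, c (g k) = ∑ k ∈ Finset.range i, c (f k) :=
          Finset.sum_congr rfl fun k hk => by simp [g, Finset.mem_range.1 hk]
        have e2 : ∑ k ∈ Finset.range r, c (g (i + k)) =
            ∑ k ∈ Finset.range r, c (f (i + (p + k))) :=
          Finset.sum_congr rfl fun k _ => by
            simp only [g]
            rw [if_neg (by omega)]
            congr 2
            omega
        rw [e1, e2]
        omega
      rw [h3]
      push_cast at h1 h2 ⊢
      nlinarith

/-- Among the short closed subwalks there is one of minimal mean cost, and the cost of every walk
grows at least at that rate. -/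
theorem exists_min_mean_cycle {S : Type*} [Fintype S] (step : S → S → Prop) (c : S → ℕ)
    (f₀ : ℕ → S) (hf₀ : ∀ n, step (f₀ n) (f₀ (n + 1))) :
    ∃ (f : ℕ → S) (i p : ℕ) (m : ℝ), (∀ n, step (f n) (f (n + 1))) ∧ 0 < p ∧
      p ≤ Fintype.card S ∧ f (i + p) = f i ∧ 0 ≤ m ∧
      ((∑ k ∈ Finset.range p, c (f (i + k)) : ℕ) : ℝ) = m * p ∧
      ∀ T : ℕ, m * ((T : ℝ) - Fintype.card S) ≤ ((∑ k ∈ Finset.range T, c (f₀ k) : ℕ) : ℝ) := by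
  let N := Fintype.card S
  let C := {x : (ℕ → S) × ℕ × ℕ // (∀ n, step (x.1 n) (x.1 (n + 1))) ∧ 0 < x.2.2 ∧
    x.2.2 ≤ N ∧ x.1 (x.2.1 + x.2.2) = x.1 x.2.1}
  let w : C → ℕ := fun x =>
    (∑ k ∈ Finset.range x.1.2.2, c (x.1.1 (x.1.2.1 + k))) * (N.factorial / x.1.2.2)
  have hC : Nonempty C := by
    obtain ⟨a, b, hab, hfab⟩ := Fintype.exists_ne_map_eq_of_card_lt
      (fun k : Fin (Fintype.card S + 1) => f₀ k) (by simp)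
    have ha := a.2
    have hb := b.2
    have hne : (a : ℕ) ≠ b := fun e => hab (Fin.ext e)
    rcases lt_or_gt_of_ne hne with hlt | hlt
    · refine ⟨⟨(f₀, a, b - a), hf₀, by simp; omega, by simp [N]; omega, ?_⟩⟩
      simp only
      rw [Nat.add_sub_cancel' hlt.le, hfab]
    · refine ⟨⟨(f₀, b, a - b), hf₀, by simp; omega, by simp [N]; omega, ?_⟩⟩
      simp only
      rw [Nat.add_sub_cancel' hlt.le, hfab]
  obtain ⟨x, hx⟩ : ∃ x : C, ∀ y, w x ≤ w y :=
    ⟨Function.argmin w, fun y => Function.argmin_le w y⟩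
  have hw : ∀ y : C, (w y : ℝ) * y.1.2.2 =
      ((∑ k ∈ Finset.range y.1.2.2, c (y.1.1 (y.1.2.1 + k)) : ℕ) : ℝ) * N.factorial := by
    intro y
    have : y.1.2.2 ∣ N.factorial := Nat.dvd_factorial y.2.2.1 y.2.2.2.1
    have e : w y * y.1.2.2 =
        (∑ k ∈ Finset.range y.1.2.2, c (y.1.1 (y.1.2.1 + k))) * N.factorial := by
      simp only [w]
      rw [mul_assoc, Nat.div_mul_cancel this]
    exact_mod_cast e
  have hN : (0 : ℝ) < N.factorial := by exact_mod_cast N.factorial_pos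
  refine ⟨x.1.1, x.1.2.1, x.1.2.2, (w x : ℝ) / N.factorial, x.2.1, x.2.2.1, x.2.2.2.1, x.2.2.2.2,
    by positivity, ?_, fun T => ?_⟩
  · rw [div_mul_eq_mul_div, hw x]
    field_simp
  · refine mul_sub_card_le_sum_walk step c _ (by positivity) ?_ T f₀ hf₀
    intro f hf i p hp hpN hcyc
    have h1 := hw ⟨(f, i, p), hf, hp, hpN, hcyc⟩
    have h2 : (w x : ℝ) ≤ w ⟨(f, i, p), hf, hp, hpN, hcyc⟩ := by exact_mod_cast hx _
    simp only at h1
    rw [div_mul_eq_mul_div, div_le_iff₀ hN, ← h1]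
    gcongr

/-- A sequence whose partial sums stay within bounded distance of `m * T` has average `m`. -/
theorem tendsto_div_of_abs_sub_le (F : ℕ → ℝ) (m K : ℝ) (h : ∀ T : ℕ, |F T - m * T| ≤ K) :
    Filter.Tendsto (fun T : ℕ => F T / T) Filter.atTop (nhds m) := by
  have hK : Filter.Tendsto (fun T : ℕ => K / (T : ℝ)) Filter.atTop (nhds 0) :=
    tendsto_const_div_atTop_nhds_zero_nat K
  rw [tendsto_iff_norm_sub_tendsto_zero]
  refine squeeze_zero' (Filter.Eventually.of_forall fun _ => norm_nonneg _) ?_ hK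
  filter_upwards [Filter.eventually_gt_atTop 0] with T hT
  have hT' : (0 : ℝ) < T := by exact_mod_cast hT
  have e : F T / T - m = (F T - m * T) / T := by field_simp
  rw [e, Real.norm_eq_abs, abs_div, abs_of_pos hT']
  gcongr
  exact h T

/-- If the partial sums of a convergent average grow at least at rate `m`, the average is at
least `m`. -/
theorem le_of_tendsto_div (F : ℕ → ℝ) (m K L : ℝ) (h : ∀ T : ℕ, m * T - K ≤ F T)
    (hL : Filter.Tendsto (fun T : ℕ => F T / T) Filter.atTop (nhds L)) : m ≤ L := by
  have hK : Filter.Tendsto (fun T : ℕ => m - K / (T : ℝ)) Filter.atTop (nhds (m - 0)) :=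
    tendsto_const_nhds.sub (tendsto_const_div_atTop_nhds_zero_nat K)
  rw [sub_zero] at hK
  refine le_of_tendsto_of_tendsto hK hL ?_
  filter_upwards [Filter.eventually_gt_atTop 0] with T hT
  have hT' : (0 : ℝ) < T := by exact_mod_cast hT
  have e : m - K / T = (m * T - K) / T := by field_simp
  rw [e]
  gcongr
  exact h T

/-- A function on `ℕ` that is periodic with a positive period is bounded in absolute value. -/
theorem exists_abs_le_of_periodic (E : ℕ → ℝ) (p : ℕ) (hp : 0 < p) (h : ∀ n, E (n + p) = E n) :
    ∃ K, ∀ n, |E n| ≤ K := by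
  refine ⟨∑ k ∈ Finset.range p, |E k|, fun n => ?_⟩
  rw [← Function.Periodic.map_mod_nat h n]
  exact Finset.single_le_sum (f := fun k => |E k|) (fun _ _ => abs_nonneg _)
    (Finset.mem_range.2 (Nat.mod_lt n hp))

/-- Partial sums of a periodic sequence, also after a shift, grow linearly at the mean rate up to
a bounded error. -/
theorem exists_abs_sum_sub_le_of_periodic (x : ℕ → ℝ) (p : ℕ) (hp : 0 < p)
    (hx : ∀ n, x (n + p) = x n) (m : ℝ) (hm : ∑ k ∈ Finset.range p, x k = m * p) (a : ℕ) :
    ∃ K, ∀ T : ℕ, |∑ k ∈ Finset.range T, x (a + k) - m * T| ≤ K := by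
  let E : ℕ → ℝ := fun T => ∑ k ∈ Finset.range T, x k - m * T
  have hE : ∀ n, E (n + p) = E n := by
    intro n
    simp only [E]
    rw [add_comm n p, Finset.sum_range_add, hm]
    have : ∑ k ∈ Finset.range n, x (p + k) = ∑ k ∈ Finset.range n, x k :=
      Finset.sum_congr rfl fun k _ => by rw [add_comm, hx]
    rw [this]
    push_cast
    ring
  obtain ⟨K, hK⟩ := exists_abs_le_of_periodic E p hp hE
  refine ⟨K + K, fun T => ?_⟩
  have e : ∑ k ∈ Finset.range T, x (a + k) - m * T = E (a + T) - E a := by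
    simp only [E]
    rw [Finset.sum_range_add]
    push_cast
    ring
  rw [e]
  exact (abs_sub _ _).trans (add_le_add (hK _) (hK _))

/-- Partial sums of eventually equal sequences stay within bounded distance. -/
theorem exists_abs_sum_sub_sum_le_of_eq (u v : ℕ → ℝ) (n₀ : ℕ) (h : ∀ t, n₀ ≤ t → u t = v t) :
    ∃ K, ∀ T : ℕ, |∑ t ∈ Finset.range T, u t - ∑ t ∈ Finset.range T, v t| ≤ K := by
  refine ⟨∑ t ∈ Finset.range n₀, |u t - v t|, fun T => ?_⟩
  rw [← Finset.sum_sub_distrib]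
  refine (Finset.abs_sum_le_sum_abs _ _).trans ?_
  rw [← Finset.sum_filter_of_ne (p := fun t => t < n₀) fun t _ ht => by
    by_contra hlt
    exact ht (by rw [h t (not_lt.1 hlt), sub_self, abs_zero])]
  exact Finset.sum_le_sum_of_subset_of_nonneg
    (fun t ht => Finset.mem_range.2 (Finset.mem_filter.1 ht).2) fun _ _ _ => abs_nonneg _

instance : Fintype Dir := ⟨{Dir.D, Dir.U}, fun x => by cases x <;> simp⟩

theorem Dir.flip_flip (d : Dir) : d.flip.flip = d := by cases d <;> rfl

theorem Dir.flip_ne (d : Dir) : d.flip ≠ d := by cases d <;> simp [Dir.flip]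

theorem Dir.toAct_ne_W (d : Dir) : d.toAct ≠ Act.W := by cases d <;> simp [Dir.toAct]

theorem Dir.toAct_injective : Function.Injective Dir.toAct := by
  intro a b h
  cases a <;> cases b <;> simp_all [Dir.toAct]

/-- The state of a single-wait schedule: the current time modulo `N`, the direction served last,
whether the lock is waiting now, and whether it waited directly before the last service. -/
structure LockState (N : ℕ) where
  time : ZMod N
  last : Dir
  waiting : Bool
  waited : Bool

namespace LockState

variable {N : ℕ}

/-- Lock states as tuples. -/
def equivProd (N : ℕ) : LockState N ≃ ZMod N × Dir × Bool × Bool where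
  toFun s := (s.time, s.last, s.waiting, s.waited)
  invFun x := ⟨x.1, x.2.1, x.2.2.1, x.2.2.2⟩
  left_inv _ := rfl
  right_inv _ := rfl

instance [NeZero N] : Fintype (LockState N) := Fintype.ofEquiv _ (equivProd N).symm

theorem card_eq [NeZero N] : Fintype.card (LockState N) = 8 * N := by
  have hD : Fintype.card Dir = 2 := rfl
  rw [Fintype.card_congr (equivProd N)]
  simp only [Fintype.card_prod, ZMod.card, Fintype.card_bool, hD]
  ring

/-- The transitions of single-wait schedules. -/
def Step (s s' : LockState N) : Prop :=
  s'.time = s.time + 1 ∧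
    ((s'.waiting = true ∧ s.waiting = false ∧ s'.last = s.last ∧ s'.waited = s.waited) ∨
      (s'.waiting = false ∧ s'.last = s.last.flip ∧ s'.waited = s.waiting))

/-- The action taken in a state. -/
def act (s : LockState N) : Act := if s.waiting then Act.W else s.last.toAct

/-- The number of vessels waiting in a state. -/
def cost (A : Dir → ZMod N → ℕ) (s : LockState N) : ℕ :=
  (if s.waiting then A s.last s.time else 0) + (A s.last.flip s.time +
    (if s.waiting then A s.last.flip (s.time - 1) else 0) +
    (if s.waited then A s.last.flip (s.time - 1 - (if s.waiting then 1 else 0)) else 0))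

variable {f : ℕ → LockState N}

theorem time_eq (hf : ∀ n, Step (f n) (f (n + 1))) (h0 : (f 0).time = 0) (n : ℕ) :
    (f n).time = n := by
  induction n with
  | zero => simpa using h0
  | succ n ih => rw [(hf n).1, ih]; push_cast; rfl

theorem feasible_act (hf : ∀ n, Step (f n) (f (n + 1))) : Feasible fun n => (f n).act := by
  intro t t' _ htt' ht ht' hW
  have key : ∀ j, t + j < t' → (f (t + j)).last = (f t).last := by
    intro j
    induction j with
    | zero => simp
    | succ j ih =>
      intro hj
      have h1 := hW (t + (j + 1)) (by omega) hj
      rcases (hf (t + j)).2 with h | h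
      · rw [← add_assoc, h.2.2.1, ih (by omega)]
      · simp only [act, ← add_assoc, h.1] at h1
        exact absurd h1 (Dir.toAct_ne_W _)
  obtain ⟨j, rfl⟩ : ∃ j, t' = t + j + 1 := ⟨t' - t - 1, by omega⟩
  have h1 := key j (by omega)
  have hw : (f t).waiting = false := by
    by_contra h
    simp [act, h] at ht
  rcases (hf (t + j)).2 with h | h
  · simp [act, h.1] at ht'
  · simp only [act, h.1, h.2.1, h1, hw]
    exact fun e => Dir.flip_ne _ (Dir.toAct_injective (by simpa using e))

variable {a : Dir → ℕ → ℕ} {A : Dir → ZMod N → ℕ}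

theorem queueLen_succ_last (hf : ∀ n, Step (f n) (f (n + 1))) (n : ℕ) :
    queueLen a (fun n => (f n).act) (f (n + 2)).last (n + 2) =
      if (f (n + 2)).waiting then a (f (n + 2)).last (n + 2) else 0 := by
  rcases (hf (n + 1)).2 with h | h
  · have h1 : (f (n + 2)).waiting = true := h.1
    have h2 : (f (n + 2)).last = (f (n + 1)).last := h.2.2.1
    rw [queueLen, queueLen]
    simp [act, h1, h2, h.2.1, (Dir.toAct_ne_W _).symm]
  · have h1 : (f (n + 2)).waiting = false := h.1
    rw [queueLen]
    simp [act, h1]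

theorem queueLen_flip_of_waiting_eq_false (hf : ∀ n, Step (f n) (f (n + 1))) (n : ℕ)
    (hw : (f (n + 3)).waiting = false) :
    queueLen a (fun n => (f n).act) (f (n + 3)).last.flip (n + 3) =
      (if (f (n + 3)).waited then a (f (n + 3)).last.flip (n + 2) else 0) +
        a (f (n + 3)).last.flip (n + 3) := by
  rcases (hf (n + 2)).2 with h | h
  · exact absurd (h.1.symm.trans hw) (by simp)
  · have h2 : (f (n + 3)).last = (f (n + 2)).last.flip := h.2.1
    have h3 : (f (n + 3)).waited = (f (n + 2)).waiting := h.2.2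
    rw [queueLen]
    have hne : (f (n + 3)).act ≠ (f (n + 3)).last.flip.toAct := by
      simp only [act, hw]
      exact fun e => Dir.flip_ne _ (Dir.toAct_injective (by simpa using e.symm))
    rw [if_neg hne, h2, h3, Dir.flip_flip, queueLen_succ_last hf]

theorem lockCost_eq_cost (hf : ∀ n, Step (f n) (f (n + 1))) (h0 : (f 0).time = 0)
    (hA : ∀ δ n, a δ n = A δ n) (n : ℕ) :
    lockCost a (fun n => (f n).act) (n + 4) = cost A (f (n + 4)) := by
  have hcost : lockCost a (fun n => (f n).act) (n + 4) =
      queueLen a (fun n => (f n).act) (f (n + 4)).last (n + 4) +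
        queueLen a (fun n => (f n).act) (f (n + 4)).last.flip (n + 4) := by
    unfold lockCost
    cases (f (n + 4)).last
    · rfl
    · exact add_comm _ _
  rw [hcost, queueLen_succ_last hf (n + 2), cost, time_eq hf h0]
  have s1 : ((n + 4 : ℕ) : ZMod N) - 1 = ((n + 3 : ℕ) : ZMod N) := by push_cast; ring
  have s2 : ((n + 3 : ℕ) : ZMod N) - 1 = ((n + 2 : ℕ) : ZMod N) := by push_cast; ring
  rw [s1]
  rcases (hf (n + 3)).2 with h | h
  · have h1 : (f (n + 4)).waiting = true := h.1
    have h2 : (f (n + 4)).last = (f (n + 3)).last := h.2.2.1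
    have h3 : (f (n + 4)).waited = (f (n + 3)).waited := h.2.2.2
    have hne : (f (n + 4)).act ≠ (f (n + 3)).last.flip.toAct := by
      simp [act, h1, (Dir.toAct_ne_W _).symm]
    rw [h2, queueLen, if_neg hne,
      queueLen_flip_of_waiting_eq_false hf n h.2.1, h3]
    simp only [h1, if_true, s2, hA]
    ring
  · have h1 : (f (n + 4)).waiting = false := h.1
    rw [queueLen_flip_of_waiting_eq_false hf (n + 1) h1]
    simp only [h1, hA, Bool.false_eq_true, if_false, sub_zero]
    ring

end LockState

/-- Serving additional periods does not increase queues. -/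
theorem queueLen_le_queueLen (a : Dir → ℕ → ℕ) (σ τ : ℕ → Act)
    (h : ∀ t, σ (t + 1) ≠ Act.W → τ (t + 1) = σ (t + 1)) (δ : Dir) (t : ℕ) :
    queueLen a τ δ t ≤ queueLen a σ δ t := by
  induction t with
  | zero => simp [queueLen]
  | succ t ih =>
    rw [queueLen, queueLen]
    by_cases hs : σ (t + 1) = δ.toAct
    · have : τ (t + 1) = δ.toAct := by rw [h t (by rw [hs]; exact Dir.toAct_ne_W _), hs]
      simp [hs, this]
    · rw [if_neg hs]
      split_ifs <;> omega

/-- A feasible schedule serves, whenever it acts, the direction opposite to the one tracked as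
served last. -/
theorem Feasible.exists_last {σ : ℕ → Act} (h : Feasible σ) :
    ∃ e : ℕ → Dir, ∀ t, (σ (t + 1) = Act.W ∧ e (t + 1) = e t) ∨
      (σ (t + 1) = (e t).flip.toAct ∧ e (t + 1) = (e t).flip) := by
  have hdir : ∀ x : Act, x ≠ Act.W → ∃ d : Dir, x = d.toAct := by
    intro x hx
    cases x
    · exact ⟨Dir.D, rfl⟩
    · exact ⟨Dir.U, rfl⟩
    · exact absurd rfl hx
  obtain ⟨d₀, hd₀⟩ : ∃ d₀ : Dir, ∀ t, σ (t + 1) ≠ Act.W →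
      (∀ s, s < t → σ (s + 1) = Act.W) → σ (t + 1) = d₀.flip.toAct := by
    by_cases hex : ∃ t, σ (t + 1) ≠ Act.W
    · classical
      obtain ⟨d, hd⟩ := hdir _ (Nat.find_spec hex)
      refine ⟨d.flip, fun t ht hs => ?_⟩
      have : Nat.find hex = t := by
        refine le_antisymm (Nat.find_min' hex ht) (not_lt.1 fun hlt => ?_)
        exact Nat.find_spec hex (hs _ hlt)
      rw [Dir.flip_flip, ← hd, this]
    · push Not at hex
      exact ⟨Dir.D, fun t ht => absurd (hex t) ht⟩
  let e : ℕ → Dir := fun t => Nat.rec d₀ (fun t d => if σ (t + 1) = Act.W then d else d.flip) t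
  have he : ∀ t, e (t + 1) = if σ (t + 1) = Act.W then e t else (e t).flip := fun _ => rfl
  have hact : ∀ t, (((∀ s, s < t → σ (s + 1) = Act.W) ∧ e t = d₀) ∨
      ∃ s, s < t ∧ σ (s + 1) = (e t).toAct ∧ ∀ r, s < r → r < t → σ (r + 1) = Act.W) →
      σ (t + 1) ≠ Act.W → σ (t + 1) = (e t).flip.toAct := by
    rintro t (⟨h1, h2⟩ | ⟨s, hst, h1, h2⟩) hW
    · rw [h2]
      exact hd₀ t hW h1
    · have h3 := h (s + 1) (t + 1) (by omega) (by omega) (by rw [h1]; exact Dir.toAct_ne_W _) hW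
        (fun r hr hrt => by
          obtain ⟨q, rfl⟩ : ∃ q, r = q + 1 := ⟨r - 1, by omega⟩
          exact h2 q (by omega) (by omega))
      obtain ⟨d, hd⟩ := hdir _ hW
      rw [h1, hd] at h3
      rw [hd]
      cases d <;> cases hq : e t <;> simp_all [Dir.flip]
  have hstep : ∀ t, ((∀ s, s < t → σ (s + 1) = Act.W) ∧ e t = d₀) ∨
      ∃ s, s < t ∧ σ (s + 1) = (e t).toAct ∧ ∀ r, s < r → r < t → σ (r + 1) = Act.W := by
    intro t
    induction t with
    | zero => exact Or.inl ⟨fun s hs => absurd hs (Nat.not_lt_zero s), rfl⟩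
    | succ t ih =>
      by_cases hW : σ (t + 1) = Act.W
      · have h1 : e (t + 1) = e t := by rw [he, if_pos hW]
        rw [h1]
        rcases ih with ⟨h2, h3⟩ | ⟨s, hs, h2, h3⟩
        · refine Or.inl ⟨fun s hs => ?_, h3⟩
          rcases Nat.lt_succ_iff_lt_or_eq.1 hs with h | rfl
          · exact h2 s h
          · exact hW
        · refine Or.inr ⟨s, by omega, h2, fun r hr hrt => ?_⟩
          rcases Nat.lt_succ_iff_lt_or_eq.1 hrt with h | rfl
          · exact h3 r hr h
          · exact hW
      · refine Or.inr ⟨t, by omega, ?_, fun r hr hrt => by omega⟩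
        rw [he, if_neg hW]
        exact hact t ih hW
  refine ⟨e, fun t => ?_⟩
  by_cases hW : σ (t + 1) = Act.W
  · exact Or.inl ⟨hW, by rw [he, if_pos hW]⟩
  · exact Or.inr ⟨hact t (hstep t) hW, by rw [he, if_neg hW]⟩

/-- Every feasible schedule is dominated by a single-wait one that serves at least as often. -/
theorem Feasible.exists_walk {σ : ℕ → Act} (h : Feasible σ) (N : ℕ) :
    ∃ f : ℕ → LockState N, (∀ n, (f n).Step (f (n + 1))) ∧ (f 0).time = 0 ∧
      ∀ t, σ (t + 1) ≠ Act.W → (f (t + 1)).act = σ (t + 1) := by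
  classical
  obtain ⟨e, he⟩ := h.exists_last
  let f : ℕ → LockState N := fun t => Nat.rec ⟨0, e 0, false, false⟩
    (fun t s => if σ (t + 1) = Act.W ∧ s.last = e t ∧ σ (t + 2) ≠ Act.W
      then ⟨s.time + 1, s.last, true, s.waited⟩
      else ⟨s.time + 1, s.last.flip, false, s.waiting⟩) t
  have hf : ∀ t, f (t + 1) = if σ (t + 1) = Act.W ∧ (f t).last = e t ∧ σ (t + 2) ≠ Act.W
      then ⟨(f t).time + 1, (f t).last, true, (f t).waited⟩
      else ⟨(f t).time + 1, (f t).last.flip, false, (f t).waiting⟩ := fun _ => rfl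
  have hflip : ∀ d d' : Dir, d ≠ d' → d.flip = d' := by
    intro d d' hd
    cases d <;> cases d' <;> simp_all [Dir.flip]
  have hinv : ∀ t, ((f t).last = e t ∨ σ (t + 1) = Act.W) ∧
      ((f t).waiting = true → σ (t + 1) ≠ Act.W) := by
    intro t
    induction t with
    | zero => exact ⟨Or.inl rfl, fun h => absurd h (by simp [f])⟩
    | succ t ih =>
      rw [hf]
      rcases he t with ⟨h1, h2⟩ | ⟨h1, h2⟩
      · split_ifs with hc
        · exact ⟨Or.inl (hc.2.1.trans h2.symm), fun _ => hc.2.2⟩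
        · refine ⟨?_, fun h => absurd h (by simp)⟩
          by_cases hd : (f t).last = e t
          · right
            by_contra hW
            exact hc ⟨h1, hd, hW⟩
          · left
            rw [h2]
            exact hflip _ _ hd
      · have hW : σ (t + 1) ≠ Act.W := by rw [h1]; exact Dir.toAct_ne_W _
        rw [if_neg fun hc => hW hc.1]
        refine ⟨Or.inl ?_, fun h => absurd h (by simp)⟩
        rw [h2, ih.1.resolve_right hW]
  refine ⟨f, fun t => ?_, rfl, fun t ht => ?_⟩
  · rw [hf]
    split_ifs with hc
    · refine ⟨rfl, Or.inl ⟨rfl, ?_, rfl, rfl⟩⟩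
      by_contra hw
      exact (hinv t).2 (by simpa using hw) hc.1
    · exact ⟨rfl, Or.inr ⟨rfl, rfl, rfl⟩⟩
  · rcases he t with ⟨h1, -⟩ | ⟨h1, -⟩
    · exact absurd h1 ht
    · rw [hf, if_neg fun hc => ht hc.1, h1, (hinv t).1.resolve_right ht]
      rfl

/-- Arrivals only depend on the time modulo the least common multiple of the periodicities. -/
theorem arrivals_mod_lcm (k : ℕ) (dir : Fin k → Dir) (lam mu : Fin k → ℕ) (δ : Dir) (t : ℕ) :
    arrivals k dir lam mu δ (t % Finset.univ.lcm lam) = arrivals k dir lam mu δ t := by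
  unfold arrivals
  refine Finset.sum_congr rfl fun i _ => ?_
  rw [Nat.mod_mod_of_dvd _ (Finset.dvd_lcm (Finset.mem_univ i))]

/-- **Lemma 3.4.** For every feasible schedule with finite long-run
average waiting time, there is a feasible schedule, periodic with some period
`P ≤ 8Λ` where `Λ = lcm(λ₁, …, λ_k)`, whose long-run average exists and is no
worse. In particular, there exists an optimal schedule that is periodic with
period at most `8Λ`. -/
theorem exists_periodic_no_worse (k : ℕ) (dir : Fin k → Dir) (lam mu : Fin k → ℕ)
    (hlam : ∀ i, 1 ≤ lam i) (hmu : ∀ i, 1 ≤ mu i ∧ mu i ≤ lam i)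
    (σ : ℕ → Act) (L : ℝ) (hfeas : Feasible σ)
    (havg : AvgCostIs (arrivals k dir lam mu) σ L) :
    ∃ (σ' : ℕ → Act) (P : ℕ) (L' : ℝ), Feasible σ' ∧ 1 ≤ P ∧
      P ≤ 8 * Finset.univ.lcm lam ∧ PeriodicSched σ' P ∧
      AvgCostIs (arrivals k dir lam mu) σ' L' ∧ L' ≤ L := by
  
  set N := Finset.univ.lcm lam with hNdef
  set a := arrivals k dir lam mu with ha
  have hN : N ≠ 0 := by
    rw [hNdef, Ne, Finset.lcm_eq_zero_iff]
    rintro ⟨i, -, hi⟩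
    have := hlam i
    omega
  have : NeZero N := ⟨hN⟩
  let A : Dir → ZMod N → ℕ := fun δ r => a δ r.val
  have hA : ∀ δ n, a δ n = A δ n := by
    intro δ n
    simp only [A, ZMod.val_natCast]
    exact (arrivals_mod_lcm k dir lam mu δ n).symm
  obtain ⟨f₀, hf₀, h0, hact⟩ := hfeas.exists_walk N
  obtain ⟨f, i, p, m, hf, hp, hpN, hcyc, hm, hsum, hlow⟩ :=
    exists_min_mean_cycle LockState.Step (LockState.cost A) (fun n => f₀ (n + 1))
      (fun n => hf₀ (n + 1))
  rw [LockState.card_eq] at hpN hlow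
  let g : ℕ → LockState N := fun n => f (i + n % p)
  have hgp : ∀ n, g (n + p) = g n := fun n => by simp [g]
  have hg : ∀ n, (g n).Step (g (n + 1)) := by
    intro n
    simp only [g]
    have hlt := Nat.mod_lt n hp
    rcases Nat.lt_or_ge (n % p + 1) p with h | h
    · have e : (n + 1) % p = n % p + 1 := by
        rw [Nat.add_mod, ← Nat.add_mod_mod]
        simp [Nat.mod_eq_of_lt h]
      rw [e]
      exact hf _
    · have e1 : n % p + 1 = p := by omega
      have e : (n + 1) % p = 0 := by
        rw [← Nat.mod_add_mod, e1, Nat.mod_self]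
      have hstep := hf (i + n % p)
      rw [add_assoc, e1, hcyc] at hstep
      rwa [e, add_zero]
  obtain ⟨b, hb⟩ : ∃ b, (g b).time = 0 := by
    refine ⟨(-(g 0).time).val, ?_⟩
    have htime : ∀ n, (g n).time = (g 0).time + n := by
      intro n
      induction n with
      | zero => simp
      | succ n ih => rw [(hg n).1, ih]; push_cast; ring
    rw [htime, ZMod.natCast_zmod_val, add_neg_cancel]
  let s : ℕ → LockState N := fun n => g (b + n)
  have hs : ∀ n, (s n).Step (s (n + 1)) := fun n => hg (b + n)
  let x : ℕ → ℝ := fun n => (LockState.cost A (g n) : ℝ)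
  have hxm : ∑ k ∈ Finset.range p, x k = m * p := by
    rw [← hsum]
    push_cast
    refine Finset.sum_congr rfl fun k hk => ?_
    simp only [x, g, Nat.mod_eq_of_lt (Finset.mem_range.1 hk)]
  have hshift : ∀ (y : ℕ → ℕ) (T : ℕ),
      ∑ t ∈ Finset.Icc 1 T, (y t : ℝ) = ∑ t ∈ Finset.range T, (y (t + 1) : ℝ) := by
    intro y T
    induction T with
    | zero => simp
    | succ T ih => rw [Finset.sum_Icc_succ_top (by omega), Finset.sum_range_succ, ih]
  refine ⟨fun n => (s n).act, p, m, LockState.feasible_act hs, hp, hpN, fun t _ => ?_, ?_, ?_⟩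
  · simp only [s, ← add_assoc, hgp]
  · obtain ⟨K₁, hK₁⟩ := exists_abs_sum_sub_le_of_periodic x p hp
      (fun n => by simp only [x, hgp]) m hxm (b + 1)
    obtain ⟨K₂, hK₂⟩ := exists_abs_sum_sub_sum_le_of_eq
      (fun t => (lockCost a (fun n => (s n).act) (t + 1) : ℝ)) (fun t => x (b + 1 + t)) 3
      (fun t ht => by
        obtain ⟨n, rfl⟩ : ∃ n, t = n + 3 := ⟨t - 3, by omega⟩
        simp only [x]
        rw [LockState.lockCost_eq_cost hs (by simpa [s] using hb) hA n]
        simp only [s]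
        congr 3
        omega)
    refine tendsto_div_of_abs_sub_le _ m (K₂ + K₁) fun T => ?_
    rw [hshift]
    exact (abs_sub_le _ _ _).trans (add_le_add (hK₂ T) (hK₁ T))
  · obtain ⟨K, hK⟩ := exists_abs_sum_sub_sum_le_of_eq
      (fun t => (lockCost a (fun n => (f₀ n).act) (t + 1) : ℝ))
      (fun t => (LockState.cost A (f₀ (t + 1)) : ℝ)) 3
      (fun t ht => by
        obtain ⟨n, rfl⟩ : ∃ n, t = n + 3 := ⟨t - 3, by omega⟩
        exact congrArg _ (LockState.lockCost_eq_cost hf₀ h0 hA n))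
    refine le_of_tendsto_div _ m (m * ((8 * N : ℕ) : ℝ) + K) L (fun T => ?_) havg
    have h1 := hlow T
    have h2 := (abs_le.1 (hK T)).1
    have h3 : ∑ t ∈ Finset.range T, (lockCost a (fun n => (f₀ n).act) (t + 1) : ℝ) ≤
        ∑ t ∈ Finset.range T, (lockCost a σ (t + 1) : ℝ) := by
      refine Finset.sum_le_sum fun t _ => ?_
      exact_mod_cast add_le_add (queueLen_le_queueLen a σ _ hact Dir.D (t + 1))
        (queueLen_le_queueLen a σ _ hact Dir.U (t + 1))
    rw [hshift]
    push_cast at h1 ⊢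
    linarith
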